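/- arXiv:0909.3146 — 5 statements merged into one kernel-verified Lean document; each statement's English description precedes it below -/
import Mathlib

section
/- Let F be a field, let q ≥ 2 and M ≥ 1 be natural numbers, let H be a natural number with 1 ≤ H ≤ M, and let γ₁,…,γ_H be arbitrary elements of F. Then there exists a nonzero polynomial c(y) ∈ F[y] of degree at most q^(M−1) − H such that the product b(y) = (y−γ₁)(y−γ₂)⋯(y−γ_H)·c(y) has all of its coefficients equal to zero except possibly the coefficients at positions 0 and q^j for j = 0, 1, …, M−1; that is, for every natural number i not belonging to the set {0} ∪ {q^j : 0 ≤ j ≤ M−1}, the coefficient of y^i in b(y) is zero. -/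
open Polynomial

/-- A monic polynomial over a field has a nonzero multiple supported on any prescribed finite set
of exponents with more elements than its degree. -/
theorem Polynomial.Monic.exists_ne_zero_mul_support_subset {F : Type*} [Field F] {p : F[X]}
    (hp : p.Monic) {s : Finset ℕ} (hs : p.natDegree < s.card) :
    ∃ c : F[X], c ≠ 0 ∧ (p * c).support ⊆ s := by
  have hdep : ¬ LinearIndependent F fun i : s ↦ AdjoinRoot.root p ^ (i : ℕ) := fun hli ↦ by
    have := (AdjoinRoot.powerBasis' hp).finite
    have hcard := hli.fintype_card_le_finrank
    rw [(AdjoinRoot.powerBasis' hp).finrank, AdjoinRoot.powerBasis'_dim, Fintype.card_coe] at hcard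
    omega
  obtain ⟨g, hg, ⟨j, hj⟩, hgj⟩ := Fintype.not_linearIndependent_iff.mp hdep
  set b : F[X] := ∑ i : s, monomial (i : ℕ) (g i) with hb
  have hcoeff (n : ℕ) : b.coeff n = ∑ i : s, if (i : ℕ) = n then g i else 0 := by
    simp [hb, finsetSum_coeff, coeff_monomial]
  have hdvd : p ∣ b := by
    rw [← AdjoinRoot.mk_eq_zero, ← hg, hb, map_sum]
    refine Finset.sum_congr rfl fun i _ ↦ ?_
    rw [← smul_X_eq_monomial, ← AdjoinRoot.smul_mk, map_pow, AdjoinRoot.mk_X]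
  obtain ⟨c, hc⟩ := hdvd
  refine ⟨c, ?_, ?_⟩
  · rintro rfl
    apply hgj
    have h := hcoeff j
    rw [hc, mul_zero, coeff_zero, Finset.sum_eq_single ⟨j, hj⟩
      (fun i _ hi ↦ if_neg fun hij ↦ hi (Subtype.ext hij)) fun h ↦ absurd (Finset.mem_univ _) h] at h
    simpa using h.symm
  · rw [← hc]
    intro n hn
    by_contra hns
    rw [mem_support_iff, hcoeff] at hn
    exact hn (Finset.sum_eq_zero fun i _ ↦ if_neg fun (h : (i : ℕ) = n) ↦ hns (h ▸ i.2))

/-- Part 1 of Lemma 2 of the paper: for any prescribed roots γ₁,…,γ_H (H ≤ M) over a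
field F, there is a nonzero polynomial c of degree at most q^(M-1) - H such that
b(y) = (y-γ₁)⋯(y-γ_H)·c(y) has all coefficients zero except possibly at positions
0 and q^j, j = 0,…,M-1. -/
theorem stmt1 (F : Type*) [Field F] (q M H : ℕ) (hq : 2 ≤ q) (hM : 1 ≤ M)
    (hH1 : 1 ≤ H) (hHM : H ≤ M) (γ : Fin H → F) :
    ∃ c : F[X], c ≠ 0 ∧ c.natDegree ≤ q ^ (M - 1) - H ∧
      ∀ i : ℕ, i ≠ 0 → (∀ j : ℕ, j < M → i ≠ q ^ j) →
        ((∏ h : Fin H, (X - C (γ h))) * c).coeff i = 0 := by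
  set p : F[X] := ∏ h : Fin H, (X - C (γ h))
  have hp : p.Monic := monic_prod_X_sub_C γ Finset.univ
  have hdeg : p.natDegree = H := by simp [p]
  set s : Finset ℕ := insert 0 ((Finset.range M).image (q ^ ·))
  have hs : s.card = M + 1 := by
    rw [Finset.card_insert_of_notMem (by simp; omega),
      Finset.card_image_of_injective _ (Nat.pow_right_injective hq), Finset.card_range]
  obtain ⟨c, hc, hsupp⟩ := hp.exists_ne_zero_mul_support_subset (s := s) (by omega)
  refine ⟨c, hc, ?_, fun i hi hij ↦ ?_⟩
  · have hmem := hsupp (natDegree_mem_support_of_nonzero (mul_ne_zero hp.ne_zero hc))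
    have hle : (p * c).natDegree ≤ q ^ (M - 1) := by
      rcases Finset.mem_insert.mp hmem with h | h
      · omega
      · obtain ⟨j, hj, h⟩ := Finset.mem_image.mp h
        rw [← h]
        exact Nat.pow_le_pow_right (by omega) (by have := Finset.mem_range.mp hj; omega)
    rw [hp.natDegree_mul' hc, hdeg] at hle
    omega
  · refine notMem_support_iff.mp fun h ↦ ?_
    rcases Finset.mem_insert.mp (hsupp h) with h | h
    · exact hi h
    · obtain ⟨j, hj, h⟩ := Finset.mem_image.mp h
      exact hij j (Finset.mem_range.mp hj) h.symm
end

section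
/- Let F be a field, let q ≥ 2 and M ≥ 1 be natural numbers, let Q ≥ 1 and H with 1 ≤ H ≤ M be natural numbers, let α₁,…,α_Q ∈ F, let γ₁,…,γ_H ∈ F, and let b(y) ∈ F[y] be a nonzero polynomial all of whose coefficients are zero except possibly those at positions 0 and q^j for j = 0,…,M−1, and which has γ₁,…,γ_H among its roots (b(γₕ) = 0 for all 1 ≤ h ≤ H). Then there exists a nonzero (Q+1)×(M+1) matrix A with entries in F such that: (i) for every 1 ≤ i ≤ Q, the row vector (1, αᵢ, αᵢ², …, αᵢ^Q) multiplied by A is the zero row vector of length M+1; and (ii) for every 1 ≤ h ≤ H, the matrix A multiplied by the column vector (1, γₕ, γₕ^q, γₕ^(q²), …, γₕ^(q^(M−1)))ᵀ is the zero column vector of length Q+1. -/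
open Polynomial

/-- The exponent of the `m`-th entry of a `q`-power column vector. -/
def qPowExponent (q m : ℕ) : ℕ := if m = 0 then 0 else q ^ (m - 1)

theorem qPowExponent_injective {q : ℕ} (hq : 2 ≤ q) : Function.Injective (qPowExponent q) := by
  have hpos : ∀ k, q ^ k ≠ 0 := fun k => pow_ne_zero k (by omega)
  intro m n h
  unfold qPowExponent at h
  split_ifs at h with hm hn hn
  · omega
  · exact absurd h.symm (hpos _)
  · exact absurd h (hpos _)
  · have := Nat.pow_right_injective hq h
    omega

theorem pow_qPowExponent {F : Type*} [Field F] (q m : ℕ) (x : F) :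
    x ^ qPowExponent q m = if m = 0 then 1 else x ^ q ^ (m - 1) := by
  unfold qPowExponent
  split_ifs <;> simp

/-- A polynomial supported on the range of an injective family of exponents is evaluated by
summing over that family. -/
theorem Polynomial.eval_eq_sum_of_support_subset_range {R ι : Type*} [Semiring R] [Fintype ι]
    {e : ι → ℕ} (he : Function.Injective e) {p : R[X]}
    (hp : ∀ n, p.coeff n ≠ 0 → n ∈ Set.range e) (x : R) :
    p.eval x = ∑ i, p.coeff (e i) * x ^ e i := by
  classical
  rw [eval_eq_sum, sum_def, ← Finset.sum_image (s := Finset.univ)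
    (f := fun n => p.coeff n * x ^ n) he.injOn]
  refine Finset.sum_subset (fun n hn => ?_) (fun n _ hn => ?_)
  · simpa using hp n (mem_support_iff.1 hn)
  · rw [notMem_support_iff.1 hn, zero_mul]

theorem exists_qPowExponent_eq {F : Type*} [Field F] {q M : ℕ} {b : F[X]}
    (hsupp : ∀ i : ℕ, i ≠ 0 → (∀ j : ℕ, j < M → i ≠ q ^ j) → b.coeff i = 0)
    (n : ℕ) (hn : b.coeff n ≠ 0) :
    n ∈ Set.range fun m : Fin (M + 1) => qPowExponent q m := by
  by_cases h0 : n = 0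
  · exact ⟨0, by simp [qPowExponent, h0]⟩
  · obtain ⟨j, hj, rfl⟩ : ∃ j < M, n = q ^ j := by
      by_contra! h
      exact hn (hsupp n h0 h)
    exact ⟨⟨j + 1, by omega⟩, by simp [qPowExponent]⟩

/-- Part 2 of Lemma 2 of the paper: given α₁,…,α_Q ∈ F and a nonzero polynomial b
whose monomial support lies in {0} ∪ {q^j : j < M} and which vanishes at γ₁,…,γ_H,
there is a nonzero (Q+1)×(M+1) matrix A annihilated on the left by every power row
vector (1, αᵢ, …, αᵢ^Q) and on the right by every q-power column vector
(1, γₕ, γₕ^q, …, γₕ^(q^(M-1)))ᵀ. -/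
theorem stmt2 (F : Type*) [Field F] (q M Q H : ℕ) (hq : 2 ≤ q) (hM : 1 ≤ M)
    (hQ : 1 ≤ Q) (hH1 : 1 ≤ H) (hHM : H ≤ M)
    (α : Fin Q → F) (γ : Fin H → F) (b : F[X]) (hb : b ≠ 0)
    (hsupp : ∀ i : ℕ, i ≠ 0 → (∀ j : ℕ, j < M → i ≠ q ^ j) → b.coeff i = 0)
    (hroots : ∀ h : Fin H, b.eval (γ h) = 0) :
    ∃ A : Matrix (Fin (Q + 1)) (Fin (M + 1)) F, A ≠ 0 ∧
      (∀ i : Fin Q, Matrix.vecMul (fun m : Fin (Q + 1) => α i ^ (m : ℕ)) A = 0) ∧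
      (∀ h : Fin H, Matrix.mulVec A
        (fun m : Fin (M + 1) => if (m : ℕ) = 0 then 1 else γ h ^ q ^ ((m : ℕ) - 1)) = 0) := by
  set e : Fin (M + 1) → ℕ := fun m => qPowExponent q m with e_def
  have he : Function.Injective e := (qPowExponent_injective hq).comp Fin.val_injective
  have hrange : ∀ n, b.coeff n ≠ 0 → n ∈ Set.range e := exists_qPowExponent_eq hsupp
  set p : F[X] := ∏ i, (X - C (α i)) with p_def
  have hmonic : p.Monic := monic_prod_X_sub_C α Finset.univ
  have hdeg : p.natDegree = Q := by simp [p_def]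
  refine ⟨Matrix.vecMulVec (fun m => p.coeff m) (fun m => b.coeff (e m)), ?_, fun i => ?_,
    fun h => ?_⟩
  · obtain ⟨n, hn⟩ : ∃ n, b.coeff n ≠ 0 := by
      by_contra! h
      exact hb (Polynomial.ext h)
    obtain ⟨m, rfl⟩ := hrange n hn
    intro hA
    have hlead : p.coeff Q = 1 := hdeg ▸ hmonic.coeff_natDegree
    have := congrFun (congrFun hA (Fin.last Q)) m
    simp [Matrix.vecMulVec_apply, hlead, hn] at this
  · have hroot : p.eval (α i) = 0 := by
      rw [p_def, eval_prod]
      exact Finset.prod_eq_zero (Finset.mem_univ i) (by simp)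
    rw [eval_eq_sum_range, hdeg, Finset.sum_range] at hroot
    rw [Matrix.vecMul_vecMulVec, dotProduct_comm, dotProduct, hroot, zero_smul]
  · have hroot := hroots h
    rw [eval_eq_sum_of_support_subset_range he hrange] at hroot
    simp_rw [← pow_qPowExponent]
    rw [Matrix.vecMulVec_mulVec, dotProduct, hroot, MulOpposite.op_zero, zero_smul]
end

section
/- Let F be a field, let q ≥ 2, M ≥ 1, k ≥ 2 be natural numbers, let K and H be natural numbers with 1 ≤ K ≤ k−1 and 1 ≤ H ≤ M, let x₁,…,x_K ∈ F and γ₁,…,γ_H ∈ F. Let X be the K×k matrix whose i-th row is (1, xᵢ, xᵢ², …, xᵢ^(k−1)), and let Γ be the (M+1)×H matrix whose h-th column is (1, γₕ, γₕ^q, γₕ^(q²), …, γₕ^(q^(M−1)))ᵀ. Then there exists a nonzero k×(M+1) matrix A with entries in F such that X·A is the K×(M+1) zero matrix and A·Γ is the k×H zero matrix. -/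
open Matrix in
theorem Matrix.exists_ne_zero_mulVec_eq_zero_of_card_lt {F m n : Type*} [Field F]
    [Fintype m] [Fintype n] (B : Matrix m n F) (h : Fintype.card m < Fintype.card n) :
    ∃ v : n → F, v ≠ 0 ∧ B *ᵥ v = 0 := by
  have hker : LinearMap.ker B.mulVecLin ≠ ⊥ :=
    LinearMap.ker_ne_bot_of_finrank_lt (by simpa using h)
  obtain ⟨v, hv, hv0⟩ := Submodule.exists_mem_ne_zero_of_ne_bot hker
  exact ⟨v, hv0, by simpa using hv⟩

/-- Existence part of Lemma 3 of the paper: for K ≤ k-1, H ≤ M, there is a nonzero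
k×(M+1) matrix A with X·A = 0 and A·Γ = 0, where X is the K×k Vandermonde matrix of
x₁,…,x_K and Γ is the (M+1)×H q-power Vandermonde matrix of γ₁,…,γ_H. -/
theorem stmt3 (F : Type*) [Field F] (q M k K H : ℕ) (hq : 2 ≤ q) (hM : 1 ≤ M)
    (hk : 2 ≤ k) (hK1 : 1 ≤ K) (hKk : K ≤ k - 1) (hH1 : 1 ≤ H) (hHM : H ≤ M)
    (x : Fin K → F) (γ : Fin H → F)
    (X : Matrix (Fin K) (Fin k) F) (hX : ∀ i m, X i m = x i ^ (m : ℕ))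
    (Γ : Matrix (Fin (M + 1)) (Fin H) F)
    (hΓ : ∀ m h, Γ m h = if (m : ℕ) = 0 then 1 else γ h ^ q ^ ((m : ℕ) - 1)) :
    ∃ A : Matrix (Fin k) (Fin (M + 1)) F, A ≠ 0 ∧ X * A = 0 ∧ A * Γ = 0 := by
  obtain ⟨u, hu, hXu⟩ := X.exists_ne_zero_mulVec_eq_zero_of_card_lt
    (by simp only [Fintype.card_fin]; omega)
  obtain ⟨w, hw, hΓw⟩ := Γ.transpose.exists_ne_zero_mulVec_eq_zero_of_card_lt
    (by simp only [Fintype.card_fin]; omega)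
  rw [Matrix.mulVec_transpose] at hΓw
  refine ⟨Matrix.vecMulVec u w, ?_, ?_, ?_⟩
  · intro h
    obtain ⟨i, hi⟩ := Function.ne_iff.mp hu
    obtain ⟨j, hj⟩ := Function.ne_iff.mp hw
    exact mul_ne_zero hi hj (congrFun (congrFun h i) j)
  · rw [Matrix.mul_vecMulVec, hXu, Matrix.zero_vecMulVec]
  · rw [Matrix.vecMulVec_mul, hΓw]
    ext i j
    simp [Matrix.vecMulVec_apply]
end

section
/- Let F be a finite field, let q ≥ 2, M ≥ 1, k ≥ 2 be natural numbers, let K and H be natural numbers with 1 ≤ K ≤ k−1 and 1 ≤ H ≤ M, let x₁,…,x_K ∈ F and γ₁,…,γ_H ∈ F. Let X be the K×k matrix whose i-th row is (1, xᵢ, xᵢ², …, xᵢ^(k−1)), and let Γ be the (M+1)×H matrix whose h-th column is (1, γₕ, γₕ^q, γₕ^(q²), …, γₕ^(q^(M−1)))ᵀ. Let C be any k×H matrix over F and P any K×(M+1) matrix over F. If there exists at least one k×(M+1) matrix A₀ over F with X·A₀ = P and A₀·Γ = C, then the set of all k×(M+1) matrices A over F satisfying X·A = P and A·Γ = C has cardinality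 at least |F|. -/
namespace Matrix

theorem exists_mulVec_eq_zero_of_card_lt {F m n : Type*} [Field F] [Fintype m] [Fintype n]
    (h : Fintype.card m < Fintype.card n) (B : Matrix m n F) : ∃ v ≠ 0, B *ᵥ v = 0 := by
  have hker : LinearMap.ker B.mulVecLin ≠ ⊥ :=
    LinearMap.ker_ne_bot_of_finrank_lt (by simpa using h)
  obtain ⟨v, hv, hv0⟩ := Submodule.exists_mem_ne_zero_of_ne_bot hker
  exact ⟨v, hv0, by simpa using hv⟩

/-- A solvable two-sided linear system `B * A = P`, `A * G = C` whose one-sided homogeneous parts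
are both underdetermined has at least as many solutions as the field has elements. -/
theorem card_le_card_solutions {F l m n o : Type*} [Field F] [Fintype F]
    [Fintype l] [Fintype m] [Fintype n] [Fintype o]
    (hlm : Fintype.card l < Fintype.card m) (hon : Fintype.card o < Fintype.card n)
    {B : Matrix l m F} {G : Matrix n o F} {P : Matrix l n F} {C : Matrix m o F}
    {A₀ : Matrix m n F} (hP : B * A₀ = P) (hC : A₀ * G = C) :
    Fintype.card F ≤ Nat.card {A : Matrix m n F // B * A = P ∧ A * G = C} := by
  obtain ⟨u, hu0, hu⟩ := exists_mulVec_eq_zero_of_card_lt hlm B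
  obtain ⟨w, hw0, hw⟩ := exists_mulVec_eq_zero_of_card_lt hon Gᵀ
  rw [mulVec_transpose] at hw
  have hN : vecMulVec u w ≠ 0 := by
    obtain ⟨i, hi⟩ := Function.ne_iff.mp hu0
    obtain ⟨j, hj⟩ := Function.ne_iff.mp hw0
    exact fun h => mul_ne_zero hi hj (congrFun₂ h i j)
  have hzero : vecMulVec u (0 : o → F) = 0 := by ext; simp [vecMulVec_apply]
  let f : F → {A : Matrix m n F // B * A = P ∧ A * G = C} := fun c =>
    ⟨A₀ + c • vecMulVec u w,
      by simp [Matrix.mul_add, mul_vecMulVec, hu, hP],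
      by simp [Matrix.add_mul, vecMulVec_mul, hw, hC, hzero]⟩
  have hf : Function.Injective f := fun a b hab =>
    smul_left_injective F hN (add_left_cancel (congrArg Subtype.val hab))
  rw [← Nat.card_eq_fintype_card]
  exact Nat.card_le_card_of_injective f hf

end Matrix

/-- Counting step in the proof of the security Proposition of the paper: if the
inhomogeneous system X·A = P, A·Γ = C has at least one solution A₀, then it has at
least |F| solutions (they form a coset of the homogeneous solution set). -/
theorem stmt5 (F : Type*) [Field F] [Fintype F] (q M k K H : ℕ) (hq : 2 ≤ q)
    (hM : 1 ≤ M) (hk : 2 ≤ k) (hK1 : 1 ≤ K) (hKk : K ≤ k - 1) (hH1 : 1 ≤ H) (hHM : H ≤ M)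
    (x : Fin K → F) (γ : Fin H → F)
    (X : Matrix (Fin K) (Fin k) F) (hX : ∀ i m, X i m = x i ^ (m : ℕ))
    (Γ : Matrix (Fin (M + 1)) (Fin H) F)
    (hΓ : ∀ m h, Γ m h = if (m : ℕ) = 0 then 1 else γ h ^ q ^ ((m : ℕ) - 1))
    (C : Matrix (Fin k) (Fin H) F) (P : Matrix (Fin K) (Fin (M + 1)) F)
    (A₀ : Matrix (Fin k) (Fin (M + 1)) F) (hA₀ : X * A₀ = P ∧ A₀ * Γ = C) :
    Fintype.card F ≤
      Nat.card {A : Matrix (Fin k) (Fin (M + 1)) F // X * A = P ∧ A * Γ = C} := by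
  exact Matrix.card_le_card_solutions (by simp only [Fintype.card_fin]; lia)
    (by simp only [Fintype.card_fin]; lia) hA₀.1 hA₀.2
end

section
/- Let p be a prime, let F be a field of characteristic p, let e ≥ 1 and set q = p^e. Let n ≥ 1 and M ≥ 1 be natural numbers, let P₀, P₁, …, P_M be polynomials in F[x], let s₁,…,sₙ ∈ F, and let g₁,…,gₙ ∈ F be elements satisfying gⱼ^q = gⱼ for all j. For each j define the tag polynomial A_{sⱼ}(x) = P₀(x) + sⱼ·P₁(x) + sⱼ^q·P₂(x) + ⋯ + sⱼ^(q^(M−1))·P_M(x). Then for every x₀ ∈ F: Σⱼ₌₁ⁿ gⱼ·A_{sⱼ}(x₀) = (Σⱼ₌₁ⁿ gⱼ)·P₀(x₀) + Σₘ₌₁^M (Σⱼ₌₁ⁿ gⱼ·sⱼ)^(q^(m−1)) · Pₘ(x₀). -/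
open Polynomial

theorem pow_pow_eq_self_of_pow_eq_self {α : Type*} [Monoid α] {a : α} {q : ℕ}
    (h : a ^ q = a) (k : ℕ) : a ^ q ^ k = a := by
  induction k with
  | zero => simp
  | succ k ih => rw [pow_succ, pow_mul, ih, h]

/-- The `q ^ k`-power map is linear over the elements fixed by the `q`-power map. -/
theorem sum_mul_pow_of_pow_eq_self {ι R : Type*} [CommSemiring R] (p : ℕ) [ExpChar R p]
    (e k : ℕ) (t : Finset ι) (g s : ι → R) (hg : ∀ j, g j ^ p ^ e = g j) :
    (∑ j ∈ t, g j * s j) ^ (p ^ e) ^ k = ∑ j ∈ t, g j * s j ^ (p ^ e) ^ k := by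
  have h := map_sum (iterateFrobenius R p (e * k)) (fun j => g j * s j) t
  simp only [iterateFrobenius_def, pow_mul p e k] at h
  simpa only [mul_pow, pow_pow_eq_self_of_pow_eq_self (hg _)] using h

/-- Correctness of the verification equation of the paper's authentication scheme:
with tag polynomials A_{sⱼ}(x) = P₀(x) + Σₘ₌₁^M sⱼ^(q^(m-1))·Pₘ(x) and network coding
coefficients gⱼ fixed by the q-power map, the combined tag evaluated at x₀ equals
(Σⱼ gⱼ)·P₀(x₀) + Σₘ₌₁^M (Σⱼ gⱼsⱼ)^(q^(m-1))·Pₘ(x₀). -/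
theorem stmt6 (p : ℕ) (hp : p.Prime) (F : Type*) [Field F] [CharP F p]
    (e : ℕ) (he : 1 ≤ e) (q : ℕ) (hq : q = p ^ e)
    (n M : ℕ) (hn : 1 ≤ n) (hM : 1 ≤ M)
    (P : Fin (M + 1) → F[X]) (s g : Fin n → F) (hg : ∀ j, g j ^ q = g j)
    (A : Fin n → F[X])
    (hA : ∀ j, A j = P 0 + ∑ m : Fin M, C (s j ^ q ^ (m : ℕ)) * P m.succ) :
    ∀ x₀ : F,
      ∑ j, g j * (A j).eval x₀ =
        (∑ j, g j) * (P 0).eval x₀ +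
          ∑ m : Fin M, (∑ j, g j * s j) ^ q ^ (m : ℕ) * (P m.succ).eval x₀ := by
  subst hq
  have : ExpChar F p := ExpChar.prime hp
  intro x₀
  simp only [hA, sum_mul_pow_of_pow_eq_self p e _ _ g s hg, eval_add, eval_finsetSum,
    eval_mul, eval_C, mul_add, Finset.sum_add_distrib, Finset.sum_mul, Finset.mul_sum]
  congr 1
  rw [Finset.sum_comm]
  simp only [mul_assoc]
end
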